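/- Let φ : Ω → Ω̃ be a homeomorphism between open subsets of X which has the Luzin N-property on all of Ω, i.e. μ(φ(A)) = 0 for every Borel A ⊆ Ω with μ(A) = 0. Then the change of variables formula ∫_E (f∘φ)(x)·φ'_v(x) dμ(x) = ∫_{φ(E)} f(y) dμ(y) holds for every Borel set E ⊆ Ω and every non-negative Borel function f : Ω̃ → [0,∞]. -/

import Mathlib

open MeasureTheory Metric Filter Topology NNReal ENNReal

/-- The volume derivative of a map `φ`, defined on an open set `Ω ⊆ X`, at a point `x`:
the (upper) limit as `r → 0⁺` of `μ(φ(B(x,r)))/μ(B(x,r))`, the image being taken over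
radii small enough that `B(x,r) ⊆ Ω` (for small `r` one has `B(x,r) ∩ Ω = B(x,r)`).
It coincides with the genuine limit whenever the latter exists; the limit exists and
is finite `μ`-a.e. in `Ω`. -/
noncomputable def volDeriv {X : Type*} [MetricSpace X] [MeasurableSpace X]
    (μ : Measure X) (Ω : Set X) (φ : X → X) (x : X) : ℝ≥0∞ :=
  Filter.limsup (fun r : ℝ => μ (φ '' (ball x r ∩ Ω)) / μ (ball x r)) (𝓝[>] 0)

/-- The ratio of the measures of open balls converges whenever the ratio for closed balls does. -/
lemma tendsto_measure_ball_div_of_closedBall {X : Type*} [PseudoMetricSpace X]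
    [MeasurableSpace X] {ρ μ : Measure X} {x : X} {L : ℝ≥0∞}
    (hpos : ∀ r : ℝ, 0 < r → μ (ball x r) ≠ 0) (hfin : ∀ r : ℝ, μ (ball x r) ≠ ⊤)
    (h : Tendsto (fun r => ρ (closedBall x r) / μ (closedBall x r)) (𝓝[>] 0) (𝓝 L)) :
    Tendsto (fun r => ρ (ball x r) / μ (ball x r)) (𝓝[>] 0) (𝓝 L) := by
  rw [(closed_nhds_basis L).tendsto_right_iff]
  rintro K ⟨hKL, hK⟩
  obtain ⟨δ, hδ, hδK⟩ := mem_nhdsGT_iff_exists_Ioo_subset.1 (h hKL)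
  filter_upwards [Ioo_mem_nhdsGT hδ] with r hr
  obtain ⟨u, hu, hur, hulim⟩ := exists_seq_strictMono_tendsto' hr.1
  have key (m : Measure X) :
      Tendsto (fun n => m (closedBall x (u n))) atTop (𝓝 (m (ball x r))) := by
    have hU : ⋃ n, closedBall x (u n) = ball x r := by
      ext y
      simp only [Set.mem_iUnion, mem_closedBall, mem_ball]
      refine ⟨fun ⟨n, hn⟩ => hn.trans_lt (hur n).2, fun hy => ?_⟩
      obtain ⟨n, hn⟩ := (hulim.eventually (lt_mem_nhds hy)).exists
      exact ⟨n, hn.le⟩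
    rw [← hU]
    exact tendsto_measure_iUnion_atTop fun a b hab => closedBall_subset_closedBall (hu.monotone hab)
  refine hK.mem_of_tendsto
    (ENNReal.Tendsto.div (key ρ) (Or.inr (hpos r hr.1)) (key μ) (Or.inl (hfin r)))
    (Eventually.of_forall fun n => hδK ⟨(hur n).1, (hur n).2.trans hr.2⟩)

lemma isUnifLocDoublingMeasure_of_ball {X : Type*} [PseudoMetricSpace X] [MeasurableSpace X]
    {μ : Measure X} (C : ℝ≥0)
    (h : ∀ (x : X) (r : ℝ), 0 < r → μ (ball x (2 * r)) ≤ (C : ℝ≥0∞) * μ (ball x r)) :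
    IsUnifLocDoublingMeasure μ := by
  refine ⟨C * C, eventually_mem_nhdsWithin.mono fun r (hr : 0 < r) x => ?_⟩
  calc μ (closedBall x (2 * r)) ≤ μ (ball x (2 * (2 * r))) :=
        measure_mono (closedBall_subset_ball (by linarith))
    _ ≤ C * μ (ball x (2 * r)) := h x _ (by positivity)
    _ ≤ C * (C * μ (ball x r)) := by gcongr; exact h x r hr
    _ ≤ C * (C * μ (closedBall x r)) := by gcongr; exact ball_subset_closedBall
    _ = (C * C : ℝ≥0) * μ (closedBall x r) := by push_cast; ring

/-- For a measure that is finite on a neighbourhood of each point of an open set, the density of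
balls is almost everywhere on that set given by the Radon-Nikodym derivative. -/
lemma ae_tendsto_measure_ball_div_rnDeriv {X : Type*} [PseudoMetricSpace X]
    [SecondCountableTopology X] [MeasurableSpace X] [BorelSpace X] (μ : Measure X)
    [IsUnifLocDoublingMeasure μ] [IsLocallyFiniteMeasure μ]
    (hpos : ∀ (x : X) (r : ℝ), 0 < r → μ (ball x r) ≠ 0)
    (hfin : ∀ (x : X) (r : ℝ), μ (ball x r) ≠ ⊤)
    (ν : Measure X) [SFinite ν] {Ω : Set X} (hΩ : IsOpen Ω)
    (hν : ∀ x ∈ Ω, ν.FiniteAtFilter (𝓝 x)) :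
    ∀ᵐ x ∂μ.restrict Ω,
      Tendsto (fun r => ν (ball x r) / μ (ball x r)) (𝓝[>] 0) (𝓝 (ν.rnDeriv μ x)) := by
  rw [ae_restrict_iff' hΩ.measurableSet, ae_iff]
  refine measure_null_of_locally_null _ fun x hx => ?_
  obtain ⟨hxΩ, -⟩ := Classical.not_imp.1 hx
  obtain ⟨V, hV, hVfin⟩ := hν x hxΩ
  obtain ⟨U, hUV, hUo, hxU⟩ := _root_.mem_nhds_iff.1 hV
  have hUfin : ν U < ⊤ := (measure_mono hUV).trans_lt hVfin
  refine ⟨_, inter_mem_nhdsWithin _ (hUo.mem_nhds hxU), ?_⟩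
  have : IsFiniteMeasure (ν.restrict U) := ⟨by simpa using hUfin⟩
  have hlim := (IsUnifLocDoublingMeasure.vitaliFamily μ 1).ae_tendsto_rnDeriv (ν.restrict U)
  have hae : ∀ᵐ y ∂μ, y ∈ U →
      Tendsto (fun r => ν (ball y r) / μ (ball y r)) (𝓝[>] 0) (𝓝 (ν.rnDeriv μ y)) := by
    filter_upwards [hlim, Measure.rnDeriv_restrict ν μ hUo.measurableSet] with y hy hyd hyU
    rw [hyd, Set.indicator_of_mem hyU] at hy
    have hc := hy.comp (IsUnifLocDoublingMeasure.tendsto_closedBall_filterAt μ (K := 1)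
      (fun _ : ℝ => y) id (l := 𝓝[>] 0) tendsto_id
      (eventually_mem_nhdsWithin.mono fun r (hr : 0 < r) =>
        mem_closedBall_self (by simpa using hr.le)))
    refine (tendsto_measure_ball_div_of_closedBall (hpos y) (hfin y) hc).congr' ?_
    obtain ⟨ε, hε, hεU⟩ := Metric.isOpen_iff.1 hUo y hyU
    filter_upwards [Ioo_mem_nhdsGT hε] with r hr
    rw [Measure.restrict_eq_self _ ((ball_subset_ball hr.2.le).trans hεU)]
  refine measure_mono_null (fun y hy => ?_) (ae_iff.1 hae)
  exact fun hyi => hy.1 fun _ => hyi hy.2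

/-- Let `φ : Ω → Ω̃` be a homeomorphism between open subsets of `X`
with the Luzin N-property on all of `Ω` : `μ(φ(A)) = 0` for every Borel `A ⊆ Ω` with
`μ(A) = 0`. Then the change of variables formula
`∫_E (f∘φ)(x)·φ'_v(x) dμ(x) = ∫_{φ(E)} f(y) dμ(y)` holds for every Borel set `E ⊆ Ω`
and every non-negative Borel function `f : Ω̃ → [0,∞]`. -/
theorem stmt7
    {X : Type*} [MetricSpace X] [CompleteSpace X] [TopologicalSpace.SeparableSpace X]
    [MeasurableSpace X] [BorelSpace X] (μ : Measure X)
    (hpos : ∀ (x : X) (r : ℝ), 0 < r → 0 < μ (ball x r))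
    (hfin : ∀ (x : X) (r : ℝ), μ (ball x r) < ⊤)
    (C_D : ℝ≥0) (hC_D : 1 ≤ C_D)
    (hdbl : ∀ (x : X) (r : ℝ), 0 < r → μ (ball x (2 * r)) ≤ (C_D : ℝ≥0∞) * μ (ball x r))
    (Ω Ω' : Set X) (hΩ : IsOpen Ω) (hΩ' : IsOpen Ω')
    (φ : X → X)
    (hmaps : Set.MapsTo φ Ω Ω') (hinj : Set.InjOn φ Ω) (hsurj : φ '' Ω = Ω')
    (hcont : ContinuousOn φ Ω)
    (hopenmap : ∀ U : Set X, U ⊆ Ω → IsOpen U → IsOpen (φ '' U))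
    (hN : ∀ A : Set X, A ⊆ Ω → MeasurableSet A → μ A = 0 → μ (φ '' A) = 0) :
    ∀ E : Set X, E ⊆ Ω → MeasurableSet E → ∀ f : X → ℝ≥0∞, Measurable f →
      ∫⁻ x in E, f (φ x) * volDeriv μ Ω φ x ∂μ = ∫⁻ y in φ '' E, f y ∂μ := by
  have : SecondCountableTopology X := UniformSpace.secondCountable_of_separable X
  have : IsUnifLocDoublingMeasure μ := isUnifLocDoublingMeasure_of_ball C_D hdbl
  have : IsLocallyFiniteMeasure μ := ⟨fun x => ⟨ball x 1, ball_mem_nhds x one_pos, hfin x 1⟩⟩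
  intro E hE hEm f hf
  let g : Ω → X := Ω.domRestrict φ
  have hgo : IsOpenEmbedding g := by
    refine .of_continuous_injective_isOpenMap hcont.domRestrict hinj.injective fun U hU => ?_
    have hgU : g '' U = φ '' (Subtype.val '' U) := by rw [Set.image_image]; rfl
    rw [hgU]
    exact hopenmap _ (Subtype.coe_image_subset _ _) (hΩ.isOpenMap_subtype_val U hU)
  have hg : MeasurableEmbedding g := hgo.measurableEmbedding
  have hv : MeasurableEmbedding (Subtype.val : Ω → X) :=
    MeasurableEmbedding.subtype_coe hΩ.measurableSet
  have : IsLocallyFiniteMeasure (μ.comap g) := by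
    refine ⟨fun z => ⟨g ⁻¹' ball (g z) 1,
      hgo.continuous.continuousAt.preimage_mem_nhds (ball_mem_nhds _ one_pos), ?_⟩⟩
    rw [hg.comap_apply]
    exact (measure_mono (Set.image_preimage_subset _ _)).trans_lt (hfin _ 1)
  let ν : Measure X := (μ.comap g).map Subtype.val
  have hνapp (s : Set X) : ν s = μ (φ '' (s ∩ Ω)) := by
    rw [hv.map_apply, hg.comap_apply]
    have : g '' (Subtype.val ⁻¹' s) = φ '' (Subtype.val '' (Subtype.val ⁻¹' s : Set Ω)) := by
      rw [Set.image_image]; rfl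
    rw [this, Subtype.image_preimage_coe, Set.inter_comm]
  have hac : ν ≪ μ := by
    refine Measure.AbsolutelyContinuous.mk fun s hs hs0 => ?_
    rw [hνapp]
    exact hN _ Set.inter_subset_right (hs.inter hΩ.measurableSet)
      (measure_mono_null Set.inter_subset_left hs0)
  have hνfin : ∀ x ∈ Ω, ν.FiniteAtFilter (𝓝 x) := by
    intro x hx
    refine ⟨φ ⁻¹' ball (φ x) 1, (hcont.continuousAt (hΩ.mem_nhds hx)).preimage_mem_nhds
      (ball_mem_nhds _ one_pos), ?_⟩
    rw [hνapp]
    exact (measure_mono ((Set.image_mono Set.inter_subset_left).trans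
      (Set.image_preimage_subset _ _))).trans_lt (hfin _ 1)
  have hderiv : ∀ᵐ x ∂μ.restrict E, volDeriv μ Ω φ x = ν.rnDeriv μ x := by
    refine ae_mono (Measure.restrict_mono hE le_rfl) ?_
    filter_upwards [ae_tendsto_measure_ball_div_rnDeriv μ (fun x r hr => (hpos x r hr).ne')
      (fun x r => (hfin x r).ne) ν hΩ hνfin] with x hx
    simp only [hνapp] at hx
    exact hx.limsup_eq
  have hfφ : AEMeasurable (fun x => f (φ x)) (μ.restrict E) :=
    hf.comp_aemeasurable ((hcont.mono hE).aemeasurable hEm)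
  calc ∫⁻ x in E, f (φ x) * volDeriv μ Ω φ x ∂μ
      = ∫⁻ x in E, (ν.rnDeriv μ * fun x => f (φ x)) x ∂μ :=
        lintegral_congr_ae (hderiv.mono fun x hx => by simp [hx, mul_comm])
    _ = ∫⁻ x in E, f (φ x) ∂ν := by
        rw [← lintegral_withDensity_eq_lintegral_mul₀ (Measure.measurable_rnDeriv ν μ).aemeasurable
          hfφ, ← restrict_withDensity hEm, Measure.withDensity_rnDeriv_eq ν μ hac]
    _ = ∫⁻ z in Subtype.val ⁻¹' E, f (g z) ∂μ.comap g := by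
        rw [hv.restrict_map, hv.lintegral_map]; rfl
    _ = ∫⁻ y in φ '' E, f y ∂μ := by
        have hgE : g '' (Subtype.val ⁻¹' E) = φ '' E := by
          have : g '' (Subtype.val ⁻¹' E) = φ '' (Subtype.val '' (Subtype.val ⁻¹' E : Set Ω)) := by
            rw [Set.image_image]; rfl
          rw [this, Subtype.image_preimage_coe, Set.inter_eq_right.2 hE]
        have hsub : φ '' E ⊆ Set.range g := hgE ▸ Set.image_subset_range _ _
        rw [hg.restrict_comap, ← hg.lintegral_map, hg.map_comap, hgE,
          Measure.restrict_restrict hg.measurableSet_range, Set.inter_eq_right.2 hsub]
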